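/- There exists a sequence (T_n) of trees with |T_n| → ∞ such that for every tree S, the limit inferior of the densities d(S, T_n) as n → ∞ is strictly positive. -/

import Mathlib

open SimpleGraph Filter

/-- The degree of a vertex, as the cardinality of its neighbour set. -/
noncomputable def ndeg {V : Type*} (G : SimpleGraph V) (v : V) : ℕ :=
  (G.neighborSet v).ncard

/-- `Z_k(G)`: the number of `k`-vertex subtrees (connected subgraphs) of `G`. -/
noncomputable def subtreeCount {V : Type*} [Fintype V] (G : SimpleGraph V) (k : ℕ) : ℕ :=
  {s : Finset V | s.card = k ∧ (G.induce (s : Set V)).Connected}.ncard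

/-- The number of embeddings (subtrees isomorphic to `S`) of a tree `S` in `G`,
counted among `k`-vertex subtrees. -/
noncomputable def embCount {V W : Type*} [Fintype V] (G : SimpleGraph V)
    (S : SimpleGraph W) (k : ℕ) : ℕ :=
  {s : Finset V | s.card = k ∧ Nonempty ((G.induce (s : Set V)) ≃g S)}.ncard

/-- The density `d(S,T)`: the number of embeddings of the `|S|`-vertex tree `S` in `T`
divided by the number of `|S|`-vertex subtrees of `T` (`0` if `T` has fewer vertices). -/
noncomputable def density {V W : Type*} [Fintype V] [Fintype W]
    (S : SimpleGraph W) (T : SimpleGraph V) : ℝ :=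
  (embCount T S (Fintype.card W) : ℝ) / (subtreeCount T (Fintype.card W) : ℝ)

/-- `max { d(S,T) : T an n-vertex tree }`. -/
noncomputable def maxDensity {W : Type*} [Fintype W] (S : SimpleGraph W) (n : ℕ) : ℝ :=
  sSup {x : ℝ | ∃ T : SimpleGraph (Fin n), T.IsTree ∧ x = density S T}

/-- The inducibility of `S`: `limsup_{n → ∞} max { d(S,T) : T an n-vertex tree }`. -/
noncomputable def inducibility {W : Type*} [Fintype W] (S : SimpleGraph W) : ℝ :=
  Filter.limsup (maxDensity S) Filter.atTop

/-- A graph is starlike if it has at most one non-leaf vertex. -/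
def IsStarlike {V : Type*} (G : SimpleGraph V) : Prop :=
  {v | ndeg G v ≠ 1}.Subsingleton

/-- A graph is pathlike if its maximum degree is at most 2. -/
def IsPathlike {V : Type*} (G : SimpleGraph V) : Prop :=
  ∀ v, ndeg G v ≤ 2

/-- The vertex set of the component of `u` in `G - v`; together with the edge `uv`, this is
the branch of `G` rooted at `v` through its neighbour `u`. -/
def branchSet {V : Type*} (G : SimpleGraph V) (v u : V) : Set V :=
  {w | ∃ p : G.Walk u w, v ∉ p.support}

/-- The branch of `G` rooted at `v` through `u` is non-trivial if it is not a single edge. -/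
def NontrivialBranch {V : Type*} (G : SimpleGraph V) (v u : V) : Prop :=
  G.Adj v u ∧ branchSet G v u ≠ {u}

/-- The branch rooted at `v` through `u` is a fork: non-trivial and isomorphic to a star in
which `v` is a leaf (all vertices of the branch other than `u` and `v` are leaves of `G`). -/
def IsFork {V : Type*} (G : SimpleGraph V) (v u : V) : Prop :=
  NontrivialBranch G v u ∧ ∀ w ∈ branchSet G v u, w ≠ u → ndeg G w = 1

/-- The order of a fork: its number of leaves other than the root. -/
noncomputable def forkOrder {V : Type*} (G : SimpleGraph V) (v u : V) : ℕ :=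
  (branchSet G v u).ncard - 1

/-- A branch is major if it is non-trivial and not a fork. -/
def IsMajor {V : Type*} (G : SimpleGraph V) (v u : V) : Prop :=
  NontrivialBranch G v u ∧ ¬ IsFork G v u

/-- A caterpillar is a tree in which every vertex is the root of at most two
non-trivial branches. -/
def IsCaterpillar {V : Type*} (G : SimpleGraph V) : Prop :=
  G.IsTree ∧ ∀ v, {u | NontrivialBranch G v u}.ncard ≤ 2

/-- A center of `G`: each branch rooted at `v` has at most `|G|/2` edges (the branch through
a neighbour `u` has `(branchSet G v u).ncard` edges). -/
def IsCenter {V : Type*} [Fintype V] (G : SimpleGraph V) (v : V) : Prop :=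
  ∀ u, G.Adj v u → 2 * (branchSet G v u).ncard ≤ Fintype.card V

/-- `v` is the root of at least three non-trivial branches. -/
def RootsThreeNontrivial {V : Type*} (G : SimpleGraph V) (v : V) : Prop :=
  3 ≤ {u | NontrivialBranch G v u}.ncard

/-- A hub of `G`: a vertex `v` that is the only vertex on the path from `v` to the nearest
center of `G` that is the root of at least three non-trivial branches.  (A vertex `w` lies on
the path from `v` to `c` iff `dist v w + dist w c = dist v c`.) -/
def IsHub {V : Type*} [Fintype V] (G : SimpleGraph V) (v : V) : Prop :=
  RootsThreeNontrivial G v ∧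
  ∃ c, IsCenter G c ∧ (∀ c', IsCenter G c' → G.dist v c ≤ G.dist v c') ∧
    ∀ w, G.dist v w + G.dist w c = G.dist v c → w ≠ v → ¬ RootsThreeNontrivial G w

/-- The graph on `Fin m` in which every vertex `j` is joined to `p j` (when `p j < m` and
`p j ≠ j`). -/
def parentGraph (m : ℕ) (p : ℕ → ℕ) : SimpleGraph (Fin m) :=
  SimpleGraph.fromRel fun a b => p a = b

theorem parentGraph_adj {m : ℕ} {p : ℕ → ℕ} {a b : Fin m} :
    (parentGraph m p).Adj a b ↔ a ≠ b ∧ (p a = b ∨ p b = a) :=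
  SimpleGraph.fromRel_adj _ a b

theorem parentGraph_connected {m : ℕ} [NeZero m] {p : ℕ → ℕ} (hp : ∀ j, p j ≤ j - 1) :
    (parentGraph m p).Connected := by
  have h : ∀ (j : ℕ) (hj : j < m), (parentGraph m p).Reachable ⟨j, hj⟩ 0 := by
    intro j
    induction j using Nat.strong_induction_on with
    | _ j ih =>
      intro hj
      rcases Nat.eq_zero_or_pos j with rfl | hpos
      · exact SimpleGraph.Reachable.refl _
      · have hlt : p j < j := (hp j).trans_lt (by omega)
        refine SimpleGraph.Reachable.trans (SimpleGraph.Adj.reachable ?_)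
          (ih (p j) hlt (hlt.trans hj))
        rw [parentGraph_adj]
        exact ⟨fun h => hlt.ne' (Fin.mk.inj_iff.1 h), Or.inl rfl⟩
  exact ⟨fun a b => (h a a.2).trans (h b b.2).symm⟩

theorem parentGraph_isTree {m : ℕ} [NeZero m] {p : ℕ → ℕ} (hp : ∀ j, p j ≤ j - 1) :
    (parentGraph m p).IsTree := by
  have hc := parentGraph_connected (m := m) hp
  rw [SimpleGraph.isTree_iff_connected_and_card]
  refine ⟨hc, le_antisymm ?_ hc.card_vert_le_card_edgeSet_add_one⟩
  let f : {a : Fin m // a ≠ 0} → Sym2 (Fin m) := fun a =>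
    s(a.1, ⟨p a.1, ((hp a.1).trans (Nat.sub_le _ 1)).trans_lt a.1.2⟩)
  have hsub : (parentGraph m p).edgeSet ⊆ Set.range f := by
    intro e
    induction e using Sym2.ind with
    | _ a b =>
      have key : ∀ a b : Fin m, a ≠ b → p a = b → s(a, b) ∈ Set.range f := by
        intro a b hab h
        by_cases ha : a = 0
        · subst ha
          exact absurd (Fin.ext (by simpa [← h] using (hp 0).antisymm (Nat.zero_le _))) hab.symm
        · exact ⟨⟨a, ha⟩, by simp [f, h]⟩
      rw [SimpleGraph.mem_edgeSet, parentGraph_adj]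
      rintro ⟨hab, h | h⟩
      · exact key a b hab h
      · rw [Sym2.eq_swap]; exact key b a hab.symm h
  have h1 : Nat.card (parentGraph m p).edgeSet ≤ Nat.card {a : Fin m // a ≠ 0} :=
    (Nat.card_mono (Set.finite_range f) hsub).trans (Finite.card_range_le f)
  have h2 : Nat.card {a : Fin m // a ≠ 0} + 1 = Nat.card (Fin m) := by
    simp [Fintype.card_subtype_compl]
    have := NeZero.pos m
    omega
  omega

theorem SimpleGraph.Connected.exists_adj_dist_lt {V : Type*} {G : SimpleGraph V}
    (hG : G.Connected) {r v : V} (h : v ≠ r) : ∃ w, G.Adj v w ∧ G.dist r w < G.dist r v := by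
  obtain ⟨q, hq⟩ := hG.exists_walk_length_eq_dist v r
  cases q with
  | nil => exact absurd rfl h
  | cons hvw q =>
    refine ⟨_, hvw, ?_⟩
    rw [SimpleGraph.dist_comm (v := v), ← hq, SimpleGraph.dist_comm, SimpleGraph.Walk.length_cons]
    exact Nat.lt_succ_of_le (SimpleGraph.dist_le q)

/-- Every finite tree is isomorphic to a parent graph. -/
theorem SimpleGraph.IsTree.exists_iso_parentGraph {W : Type*} [Fintype W] {S : SimpleGraph W}
    (hS : S.IsTree) : ∃ p : ℕ → ℕ, (∀ j, p j ≤ j - 1) ∧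
      Nonempty (parentGraph (Fintype.card W) p ≃g S) := by
  classical
  obtain ⟨r⟩ := hS.connected.nonempty
  have : NeZero (Fintype.card W) := ⟨(Fintype.card_pos_iff.2 ⟨r⟩).ne'⟩
  let e₀ : Fin (Fintype.card W) ≃ W := (Fintype.equivFin W).symm
  let e : Fin (Fintype.card W) ≃ W := (Tuple.sort fun i => S.dist r (e₀ i)).trans e₀
  have hmono : Monotone fun i => S.dist r (e i) := Tuple.monotone_sort fun i => S.dist r (e₀ i)
  have he0 : e 0 = r := by
    have h : S.dist r (e 0) ≤ S.dist r (e (e.symm r)) := hmono (Fin.zero_le _)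
    rw [e.apply_symm_apply, SimpleGraph.dist_self, Nat.le_zero] at h
    exact (hS.connected.dist_eq_zero_iff.1 h).symm
  have hex : ∀ j : ℕ, ∃ i : ℕ, i ≤ j - 1 ∧ ∀ hj : j < Fintype.card W, 0 < j →
      ∃ hi : i < Fintype.card W, S.Adj (e ⟨j, hj⟩) (e ⟨i, hi⟩) := by
    intro j
    by_cases hj : j < Fintype.card W ∧ 0 < j
    · obtain ⟨w, hadj, hlt⟩ := hS.connected.exists_adj_dist_lt (r := r) (v := e ⟨j, hj.1⟩) (by
        rw [← he0]
        intro h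
        exact hj.2.ne' (Fin.mk.inj_iff.1 (e.injective h)))
      refine ⟨e.symm w, ?_, fun _ _ => ⟨(e.symm w).2, by simpa using hadj⟩⟩
      have : e.symm w < ⟨j, hj.1⟩ := by
        by_contra hcon
        have := hmono (not_lt.1 hcon)
        simp only [e.apply_symm_apply] at this
        omega
      have : (e.symm w : ℕ) < j := this
      omega
    · exact ⟨0, Nat.zero_le _, fun h1 h2 => absurd ⟨h1, h2⟩ hj⟩
  choose p hp hpadj using hex
  refine ⟨p, hp, ?_⟩
  have hle : (parentGraph (Fintype.card W) p).comap e.symm ≤ S := by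
    have key : ∀ a b : Fin (Fintype.card W), a ≠ b → p a = b → S.Adj (e a) (e b) := by
      intro a b hab h
      have ha : 0 < (a : ℕ) := by
        rcases Nat.eq_zero_or_pos (a : ℕ) with h0 | h0
        · have := hp a
          exact absurd (Fin.ext (by omega)) hab
        · exact h0
      obtain ⟨hi, hadj⟩ := hpadj a a.2 ha
      have hb : (⟨p a, hi⟩ : Fin (Fintype.card W)) = b := Fin.ext h
      rwa [hb] at hadj
    intro u v huv
    rw [SimpleGraph.comap_adj, parentGraph_adj] at huv
    obtain ⟨hne, h | h⟩ := huv
    · simpa using key _ _ hne h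
    · simpa using (key _ _ hne.symm h).symm
  have hiso := SimpleGraph.Iso.comap e.symm (parentGraph (Fintype.card W) p)
  have hconn : ((parentGraph (Fintype.card W) p).comap e.symm).Connected :=
    hiso.connected_iff.2 (parentGraph_connected hp)
  have heq := (SimpleGraph.isTree_iff_minimal_connected.1 hS).eq_of_le hconn hle
  rw [← heq]
  exact ⟨hiso.symm⟩

theorem card_le_embCount {M k : ℕ} {W : Type*} {S : SimpleGraph W} {p q : ℕ → ℕ} (hk : 0 < k)
    (hp : ∀ j, p j ≤ j - 1) (hq : ∀ j, q j ≤ j - 1) (iso : parentGraph k p ≃g S) (A : Finset ℕ)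
    (hA : ∀ a ∈ A, a + k ≤ M ∧ ∀ t, 0 < t → t < k → q (a + t) = a + p t) :
    A.card ≤ embCount (parentGraph M q) S k := by
  let f : ℕ → Finset (Fin M) := fun a => Finset.univ.filter fun i => a ≤ (i : ℕ) ∧ (i : ℕ) < a + k
  have hmem : ∀ a (i : Fin M), i ∈ f a ↔ a ≤ (i : ℕ) ∧ (i : ℕ) < a + k := fun a i => by simp [f]
  have hinj : Set.InjOn f A := by
    have key : ∀ a ∈ A, ∀ b ∈ A, f a = f b → b ≤ a := by
      intro a ha b hb hab
      have : (⟨a, by have := (hA a ha).1; omega⟩ : Fin M) ∈ f a := by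
        rw [hmem]; exact ⟨le_rfl, by simpa using hk⟩
      rw [hab, hmem] at this
      exact this.1
    exact fun a ha b hb hab => le_antisymm (key b hb a ha hab.symm) (key a ha b hb hab)
  rw [← Set.ncard_coe_finset, ← hinj.ncard_image]
  refine Set.ncard_le_ncard ?_ (Set.toFinite _)
  rintro _ ⟨a, ha, rfl⟩
  obtain ⟨haM, hpar⟩ := hA a ha
  let e : Fin k ≃ (f a : Set (Fin M)) :=
    { toFun := fun t => ⟨⟨a + t, by omega⟩, by
        rw [Finset.mem_coe, hmem]; exact ⟨Nat.le_add_right _ _, by simp⟩⟩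
      invFun := fun i => ⟨i.1 - a, by
        have := (hmem a i.1).1 i.2
        omega⟩
      left_inv := fun t => by simp
      right_inv := fun i => by
        have := (hmem a i.1).1 i.2
        apply Subtype.ext
        apply Fin.ext
        change a + (i.1 - a : ℕ) = i.1
        omega }
  have heval : ∀ t : Fin k, ((e t).1 : ℕ) = a + t := fun _ => rfl
  have hrel : ∀ t u : Fin k, t ≠ u → (q (e t).1 = (e u).1 ↔ p t = u) := by
    intro t u htu
    rw [heval, heval]
    rcases Nat.eq_zero_or_pos (t : ℕ) with h0 | h0
    · have h1 := hq (a + t)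
      have h2 := hp t
      have h3 : (t : ℕ) ≠ u := fun h => htu (Fin.ext h)
      omega
    · rw [hpar t h0 t.2]
      omega
  have hiso : parentGraph k p ≃g (parentGraph M q).induce (f a : Set (Fin M)) :=
    { toEquiv := e
      map_rel_iff' := by
        intro t u
        rw [SimpleGraph.comap_adj, parentGraph_adj, parentGraph_adj]
        have hne : (e t).1 ≠ (e u).1 ↔ t ≠ u := by
          rw [Ne, Subtype.val_injective.eq_iff, e.injective.eq_iff]
        change (e t).1 ≠ (e u).1 ∧ (q (e t).1 = (e u).1 ∨ q (e u).1 = (e t).1) ↔ _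
        rw [hne]
        refine and_congr_right fun htu => ?_
        rw [hrel t u htu, hrel u t htu.symm] }
  refine ⟨?_, ⟨hiso.symm.trans iso⟩⟩
  have := Fintype.card_congr e
  simpa using this.symm

theorem subtreeCount_parentGraph_le (M k : ℕ) {q : ℕ → ℕ} (hq : ∀ j, q j ≤ j - 1) :
    subtreeCount (parentGraph M q) k ≤ ∑ l ∈ Finset.range M, (2 * (k * (l - q l)) + 1) ^ k := by
  classical
  let I : Fin M → Finset (Fin M) := fun l => Finset.univ.filter fun v =>
    (v : ℕ) ≤ l + k * (l - q l) ∧ (l : ℕ) ≤ v + k * (l - q l)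
  have hI : ∀ l, (I l).card ≤ 2 * (k * (l - q l)) + 1 := by
    intro l
    calc (I l).card = ((I l).map Fin.valEmbedding).card := (Finset.card_map _).symm
      _ ≤ (Finset.Icc ((l : ℕ) - k * (l - q l)) (l + k * (l - q l))).card := by
        refine Finset.card_le_card fun v hv => ?_
        obtain ⟨w, hw, rfl⟩ := Finset.mem_map.1 hv
        simp only [I, Finset.mem_filter, Finset.mem_univ, true_and] at hw
        simp only [Fin.valEmbedding_apply, Finset.mem_Icc]
        omega
      _ ≤ _ := by rw [Nat.card_Icc]; omega
  have hsub : {s : Finset (Fin M) | s.card = k ∧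
      ((parentGraph M q).induce (s : Set (Fin M))).Connected} ⊆
      ((Finset.univ.biUnion fun l => (I l).powersetCard k : Finset (Finset (Fin M))) :
        Set (Finset (Fin M))) := by
    rintro s ⟨hs, hconn⟩
    obtain ⟨⟨v₀, hv₀⟩⟩ := hconn.nonempty
    obtain ⟨l, hl, hmax⟩ := s.exists_max_image (fun v => (v : ℕ) - q v) ⟨v₀, hv₀⟩
    have hwalk : ∀ (u v : (s : Set (Fin M)))
        (w : ((parentGraph M q).induce (s : Set (Fin M))).Walk u v),
        (v.1 : ℕ) ≤ u.1 + w.length * (l - q l) ∧ (u.1 : ℕ) ≤ v.1 + w.length * (l - q l) := by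
      intro u v w
      induction w with
      | nil => simp
      | @cons a b c hab w ih =>
        have hadj := parentGraph_adj.1 (SimpleGraph.comap_adj.1 hab)
        change _ ∧ (q a.1 = b.1 ∨ q b.1 = a.1) at hadj
        have h1 := hmax a.1 a.2
        have h2 := hmax b.1 b.2
        have h3 := hq a.1
        have h4 := hq b.1
        rw [SimpleGraph.Walk.length_cons, Nat.succ_mul]
        omega
    simp only [Finset.coe_biUnion, Set.mem_iUnion, Finset.mem_coe, Finset.mem_powersetCard]
    refine ⟨l, Finset.mem_univ _, fun v hv => ?_, hs⟩
    obtain ⟨w, hw⟩ := (hconn.preconnected ⟨l, hl⟩ ⟨v, hv⟩).exists_isPath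
    have hlen : w.length < k := by simpa [hs] using hw.length_lt
    have h := hwalk _ _ w
    have hmul := Nat.mul_le_mul_right (l - q l) hlen.le
    simp only [I, Finset.mem_filter, Finset.mem_univ, true_and]
    simp only at h
    omega
  calc subtreeCount (parentGraph M q) k
      ≤ (Finset.univ.biUnion fun l => (I l).powersetCard k).card := by
        rw [← Set.ncard_coe_finset]
        exact Set.ncard_le_ncard hsub (Set.toFinite _)
    _ ≤ ∑ l, ((I l).powersetCard k).card := Finset.card_biUnion_le
    _ ≤ ∑ l : Fin M, (2 * (k * ((l : ℕ) - q l)) + 1) ^ k := by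
        refine Finset.sum_le_sum fun l _ => ?_
        rw [Finset.card_powersetCard]
        exact (Nat.choose_le_pow _ _).trans (Nat.pow_le_pow_left (hI l) k)
    _ = _ := Fin.sum_univ_eq_sum_range (fun l => (2 * (k * (l - q l)) + 1) ^ k) M

theorem embCount_le_subtreeCount {V W : Type*} [Fintype V] (G : SimpleGraph V)
    {S : SimpleGraph W} (hS : S.Connected) (k : ℕ) : embCount G S k ≤ subtreeCount G k :=
  Set.ncard_le_ncard (fun _ hs => ⟨hs.1, hs.2.elim fun e => e.connected_iff.2 hS⟩) (Set.toFinite _)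

/-- A sequence of bounded words such that every finite word is a prefix of one of them. -/
theorem exists_universal_words : ∃ P : ℕ → ℕ → ℕ, (∀ i t, P i t ≤ i) ∧
    ∀ (g : ℕ → ℕ) (k : ℕ), ∃ i, k ≤ i ∧ ∀ t < k, P i t = g t := by
  obtain ⟨f, hf⟩ := exists_surjective_nat (List ℕ)
  refine ⟨fun i t => min i ((f (Nat.unpair i).1).getD t 0), fun i t => min_le_left _ _, ?_⟩
  intro g k
  obtain ⟨n, hn⟩ := hf ((List.range k).map g)
  refine ⟨Nat.pair n (k + ∑ t ∈ Finset.range k, g t),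
    (Nat.le_add_right _ _).trans (Nat.right_le_pair _ _), fun t ht => ?_⟩
  have h1 : g t ≤ Nat.pair n (k + ∑ t ∈ Finset.range k, g t) :=
    ((Finset.single_le_sum (f := g) (fun _ _ => Nat.zero_le _) (Finset.mem_range.2 ht)).trans
      (Nat.le_add_left _ _)).trans (Nat.right_le_pair _ _)
  simp [hn, ht, h1]

theorem sum_range_two_pow_log (F : ℕ → ℕ) (N : ℕ) :
    ∑ l ∈ Finset.range (2 ^ N), F (Nat.log 2 l) =
      F 0 + ∑ j ∈ Finset.range N, 2 ^ j * F j := by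
  induction N with
  | zero => simp
  | succ N ih =>
    rw [Finset.sum_range_succ, ← add_assoc, ← ih, pow_succ, mul_two, Finset.sum_range_add]
    congr 1
    rw [Finset.sum_congr rfl (g := fun _ => F N), Finset.sum_const, Finset.card_range,
      smul_eq_mul]
    intro x hx
    rw [Finset.mem_range] at hx
    rw [Nat.log_eq_of_pow_le_of_lt_pow (Nat.le_add_right _ _) (by rw [pow_succ]; omega)]

theorem exists_sum_log_le (k : ℕ) : ∃ C : ℝ, ∀ n : ℕ,
    ((∑ l ∈ Finset.range (2 ^ n), (2 * (k * (n - Nat.log 2 l + 1)) + 1) ^ k : ℕ) : ℝ) ≤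
      C * 2 ^ n := by
  let h : ℕ → ℝ := fun i => (2 * (k * (i + 1)) + 1 : ℝ) ^ k * (1 / 2) ^ i
  have hh : ∀ i, 0 ≤ h i := fun i => by positivity
  have hsum : Summable h := by
    have hs := (summable_pow_mul_geometric_of_norm_lt_one (R := ℝ) k (r := 1 / 2)
      (by norm_num)).comp_injective (Nat.succ_injective)
    refine Summable.of_nonneg_of_le hh (fun i => ?_) (hs.mul_left (2 * (2 * k + 1 : ℝ) ^ k))
    have h1 : (2 * (k * (i + 1)) + 1 : ℝ) ≤ (2 * k + 1) * (i + 1) := by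
      have : (0 : ℝ) ≤ i := Nat.cast_nonneg i
      nlinarith
    have h2 := pow_le_pow_left₀ (by positivity) h1 k
    rw [mul_pow] at h2
    have h3 := mul_le_mul_of_nonneg_right h2 (by positivity : (0 : ℝ) ≤ (1 / 2) ^ i)
    refine h3.trans (le_of_eq ?_)
    simp only [Function.comp, Nat.succ_eq_add_one, pow_succ, Nat.cast_add, Nat.cast_one]
    ring
  refine ⟨2 * ∑' i, h i, fun n => ?_⟩
  rw [sum_range_two_pow_log (fun j => (2 * (k * (n - j + 1)) + 1) ^ k) n]
  have hterm : ∀ j ≤ n, (2 : ℝ) ^ j * (((2 * (k * (n - j + 1)) + 1) ^ k : ℕ) : ℝ) =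
      2 ^ n * h (n - j) := by
    intro j hj
    obtain ⟨i, rfl⟩ := Nat.exists_eq_add_of_le hj
    simp only [h, Nat.add_sub_cancel_left, pow_add, one_div, inv_pow]
    push_cast
    field_simp
  have h0 := hterm 0 (Nat.zero_le _)
  rw [pow_zero, one_mul, Nat.sub_zero] at h0
  have hs1 : h n ≤ ∑' i, h i := hsum.le_tsum n fun i _ => hh i
  have hs2 : ∑ j ∈ Finset.range n, h (n - j) ≤ ∑' i, h i := by
    have : ∑ j ∈ Finset.range n, h (n - j) = ∑ i ∈ Finset.range n, h (i + 1) := by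
      rw [← Finset.sum_range_reflect]
      refine Finset.sum_congr rfl fun j hj => ?_
      rw [Finset.mem_range] at hj
      congr 1
      omega
    rw [this]
    have h4 := hsum.sum_le_tsum (Finset.range (n + 1)) fun i _ => hh i
    rw [Finset.sum_range_succ'] at h4
    linarith [hh 0]
  push_cast
  push_cast at h0 hterm
  rw [Nat.sub_zero, h0, Finset.sum_congr rfl fun j hj => hterm j (Finset.mem_range.1 hj).le,
    ← Finset.mul_sum]
  have hpos : (0 : ℝ) < 2 ^ n := by positivity
  nlinarith

theorem card_le_embCount_of_word {W : Type*} {S : SimpleGraph W} {P : ℕ → ℕ → ℕ} {p : ℕ → ℕ}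
    {n k i : ℕ} (hk : 0 < k) (hki : k ≤ i) (hin : 2 * i ≤ n) (hp : ∀ j, p j ≤ j - 1)
    (iso : parentGraph k p ≃g S) (hP : ∀ t < k, P i t = t - 1 - p t) :
    2 ^ (n - 2 * i) ≤ embCount (parentGraph (2 ^ n) fun j =>
      j - 1 - P (n - Nat.log 2 j) (j % 2 ^ (n - Nat.log 2 j))) S k := by
  obtain ⟨d, rfl⟩ := Nat.exists_eq_add_of_le hin
  rw [Nat.add_sub_cancel_left]
  have hcard : ((Finset.Ico (2 ^ d) (2 ^ (d + 1))).image fun b => 2 ^ i * b).card = 2 ^ d := by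
    rw [Finset.card_image_of_injective _ fun a b h =>
      Nat.eq_of_mul_eq_mul_left (by positivity) h, Nat.card_Ico, pow_succ]
    omega
  rw [← hcard]
  refine card_le_embCount hk hp (fun j => Nat.sub_le _ _) iso _ fun a ha => ?_
  obtain ⟨b, hb, rfl⟩ := Finset.mem_image.1 ha
  rw [Finset.mem_Ico] at hb
  have hi2 : i < 2 ^ i := Nat.lt_two_pow_self
  have hlow : 2 ^ (d + i) ≤ 2 ^ i * b := by
    rw [pow_add, mul_comm]
    exact Nat.mul_le_mul_left _ hb.1
  have hhigh : 2 ^ i * b + 2 ^ i ≤ 2 ^ (d + i + 1) := by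
    calc 2 ^ i * b + 2 ^ i = 2 ^ i * (b + 1) := by ring
      _ ≤ 2 ^ i * 2 ^ (d + 1) := Nat.mul_le_mul_left _ hb.2
      _ = 2 ^ (d + i + 1) := by ring
  have htop : 2 ^ (d + i + 1) ≤ 2 ^ (2 * i + d) := Nat.pow_le_pow_right (by norm_num) (by omega)
  refine ⟨by omega, fun t ht htk => ?_⟩
  have hlog : Nat.log 2 (2 ^ i * b + t) = d + i :=
    Nat.log_eq_of_pow_le_of_lt_pow (by omega) (by omega)
  have hsub : 2 * i + d - (d + i) = i := by omega
  have hmod : (2 ^ i * b + t) % 2 ^ i = t := by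
    rw [Nat.mul_add_mod, Nat.mod_eq_of_lt (by omega)]
  simp only [hlog, hsub, hmod, hP t htk]
  have := hp t
  omega

/-- There exists a sequence of trees T n with |T n| → ∞ such that for
every tree S, liminf d(S, T n) > 0. -/
theorem exists_universal_tree_sequence :
    ∃ (m : ℕ → ℕ) (T : ∀ n, SimpleGraph (Fin (m n))),
      (∀ n, (T n).IsTree) ∧
      Filter.Tendsto m Filter.atTop Filter.atTop ∧
      ∀ (W : Type) [Fintype W] (S : SimpleGraph W), S.IsTree →
        0 < Filter.liminf (fun n => density S (T n)) Filter.atTop := by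
  obtain ⟨P, hPle, hP⟩ := exists_universal_words
  let q : ℕ → ℕ → ℕ := fun n j => j - 1 - P (n - Nat.log 2 j) (j % 2 ^ (n - Nat.log 2 j))
  have hq : ∀ n j, q n j ≤ j - 1 := fun n j => Nat.sub_le _ _
  refine ⟨fun n => 2 ^ n, fun n => parentGraph (2 ^ n) (q n),
    fun n => parentGraph_isTree (hq n), tendsto_pow_atTop_atTop_of_one_lt one_lt_two, ?_⟩
  intro W _ S hS
  obtain ⟨p, hp, ⟨iso⟩⟩ := hS.exists_iso_parentGraph
  have hk : 0 < Fintype.card W := Fintype.card_pos_iff.2 hS.connected.nonempty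
  set k := Fintype.card W with hkdef
  obtain ⟨i, hki, hPi⟩ := hP (fun t => t - 1 - p t) k
  obtain ⟨C, hC⟩ := exists_sum_log_le k
  have hemb : ∀ n, 2 * i ≤ n → 2 ^ (n - 2 * i) ≤ embCount (parentGraph (2 ^ n) (q n)) S k :=
    fun n hn => card_le_embCount_of_word hk hki hn hp iso hPi
  have hle : ∀ n, embCount (parentGraph (2 ^ n) (q n)) S k ≤
      subtreeCount (parentGraph (2 ^ n) (q n)) k :=
    fun n => embCount_le_subtreeCount _ hS.connected k
  have hsub : ∀ n, (subtreeCount (parentGraph (2 ^ n) (q n)) k : ℝ) ≤ C * 2 ^ n := by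
    intro n
    refine le_trans (Nat.cast_le.2 ((subtreeCount_parentGraph_le _ k (hq n)).trans
      (Finset.sum_le_sum fun l _ => ?_))) (hC n)
    have hgap : l - q n l ≤ n - Nat.log 2 l + 1 := by
      have := hPle (n - Nat.log 2 l) (l % 2 ^ (n - Nat.log 2 l))
      simp only [q]
      omega
    gcongr
  have hCpos : 0 < C := by
    have h1 := (Nat.one_le_two_pow.trans (hemb (2 * i) le_rfl)).trans (hle (2 * i))
    have h2 : (1 : ℝ) ≤ C * 2 ^ (2 * i) := (by exact_mod_cast h1 : (1 : ℝ) ≤ _).trans (hsub _)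
    exact pos_of_mul_pos_left (one_pos.trans_le h2) (by positivity)
  have hbound : ∀ n, density S (parentGraph (2 ^ n) (q n)) ≤ 1 := fun n =>
    div_le_one_of_le₀ (Nat.cast_le.2 (hle n)) (Nat.cast_nonneg _)
  have hpos : 0 < 1 / (C * 2 ^ (2 * i)) := by positivity
  refine hpos.trans_le (Filter.le_liminf_of_le
    (Filter.isBoundedUnder_of ⟨1, hbound⟩).isCoboundedUnder_ge ?_)
  filter_upwards [Filter.eventually_ge_atTop (2 * i)] with n hn
  have hembn : (2 : ℝ) ^ (n - 2 * i) ≤ embCount (parentGraph (2 ^ n) (q n)) S k := by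
    exact_mod_cast hemb n hn
  have hsubpos : (0 : ℝ) < subtreeCount (parentGraph (2 ^ n) (q n)) k :=
    (by positivity : (0 : ℝ) < 2 ^ (n - 2 * i)).trans_le
      (hembn.trans (Nat.cast_le.2 (hle n)))
  calc 1 / (C * 2 ^ (2 * i)) = 2 ^ (n - 2 * i) / (C * 2 ^ n) := by
        obtain ⟨d, rfl⟩ := Nat.exists_eq_add_of_le hn
        rw [Nat.add_sub_cancel_left, pow_add]
        field_simp
    _ ≤ density S (parentGraph (2 ^ n) (q n)) :=
        div_le_div₀ (Nat.cast_nonneg _) hembn hsubpos (hsub n)
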